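/- Let M be a finite set of m ≥ 21 items and consider two agents with additive dichotomous valuations on M. There is no deterministic allocation mechanism Mech, mapping each pair (D_1, D_2) of demand sets (i.e., each pair of additive dichotomous valuations f_i(S) = |S ∩ D_i|) to an allocation (A_1, A_2) with A_1 ∪ A_2 = M (all items allocated), satisfying all of the following for every pair of reports: (i) truthfulness: for every agent i and every alternative demand set D'_i, |Mech(D'_i, D_{-i})_i ∩ D_i| ≤ |Mech(D_1, D_2)_i ∩ D_i|; (ii) the output maximizes the welfare |A_1 ∩ D_1| + |A_2 ∩ D_2| over all allocations; and (iii) the output is EFX with respect to the reported valuations. -/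

import Mathlib

open Finset
open scoped Classical

variable {n : ℕ} {I : Type*} [DecidableEq I] [Fintype I]

/-- An allocation assigns pairwise disjoint bundles of items to the agents
(items may remain unallocated). -/
def IsAllocation (A : Fin n → Finset I) : Prop :=
  ∀ i j : Fin n, i ≠ j → Disjoint (A i) (A j)

/-- The vector of utilities of an allocation under a profile of valuations. -/
def util {α : Type*} (f : Fin n → Finset I → α) (A : Fin n → Finset I) : Fin n → α :=
  fun i => f i (A i)

/-- The entries of the vector `u`, sorted in nondecreasing order. -/
noncomputable def sortedVec {α : Type*} [LinearOrder α] (u : Fin n → α) : List α :=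
  (Finset.univ.val.map u).sort (· ≤ ·)

/-- `u` Lorenz-dominates `v`: for each `k`, the sum of the `k` smallest entries of `u`
is at least the sum of the `k` smallest entries of `v`. -/
def LorenzGE {α : Type*} [LinearOrder α] [AddCommMonoid α] (u v : Fin n → α) : Prop :=
  ∀ k : ℕ, ((sortedVec v).take k).sum ≤ ((sortedVec u).take k).sum

/-- A matroid rank function: a normalized submodular valuation with dichotomous marginals. -/
structure IsMRF (f : Finset I → ℕ) : Prop where
  empty : f ∅ = 0
  submod : ∀ S T : Finset I, S ⊆ T → ∀ a : I,
      f (insert a T) + f S ≤ f (insert a S) + f T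
  dichot : ∀ (S : Finset I) (a : I), f (insert a S) = f S ∨ f (insert a S) = f S + 1

/-- Non-redundancy: removing any item from any agent's bundle strictly decreases its value. -/
def NonRedundant (f : Fin n → Finset I → ℕ) (A : Fin n → Finset I) : Prop :=
  ∀ i : Fin n, ∀ a ∈ A i, f i ((A i).erase a) < f i (A i)

/-- A Lorenz dominating allocation. -/
def LorenzDominating (f : Fin n → Finset I → ℕ) (A : Fin n → Finset I) : Prop :=
  ∀ B : Fin n → Finset I, IsAllocation B → LorenzGE (util f A) (util f B)

/-- The σ-perturbed utilities: agent `i` gets `f i (A i) + σ(i)/n²`, where the priority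
`σ(i)` ranges over `{1,…,n}`. -/
noncomputable def pUtil (σ : Equiv.Perm (Fin n)) (f : Fin n → Finset I → ℕ)
    (A : Fin n → Finset I) : Fin n → ℝ :=
  fun i => (f i (A i) : ℝ) + (((σ i : ℕ) : ℝ) + 1) / (n : ℝ) ^ 2

/-- A σ-Lorenz dominating allocation. -/
def SigmaLorenzDom (σ : Equiv.Perm (Fin n)) (f : Fin n → Finset I → ℕ)
    (A : Fin n → Finset I) : Prop :=
  ∀ B : Fin n → Finset I, IsAllocation B → LorenzGE (pUtil σ f A) (pUtil σ f B)

/-- Restriction of a valuation to a subset `D` of the items. -/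
def restrictVal (f : Finset I → ℕ) (D : Finset I) : Finset I → ℕ := fun S => f (S ∩ D)

/-- A partition of all the items into `n` (possibly empty) bundles. -/
def IsPartition (P : Fin n → Finset I) : Prop :=
  (∀ i j : Fin n, i ≠ j → Disjoint (P i) (P j)) ∧ ∀ a : I, ∃ j, a ∈ P j

/-- An XOS valuation: the pointwise maximum of a finite nonempty family of
nonnegative additive valuations. -/
def IsXOS (f : Finset I → ℝ) : Prop :=
  ∃ (k : ℕ) (w : Fin (k + 1) → I → ℝ),
    (∀ t a, 0 ≤ w t a) ∧
    ∀ S : Finset I, f S = Finset.univ.sup' Finset.univ_nonempty (fun t => ∑ a ∈ S, w t a)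

/-- A dichotomous valuation (real-valued version). -/
def IsDichotomousR (f : Finset I → ℝ) : Prop :=
  ∀ (S : Finset I) (a : I), f (insert a S) = f S ∨ f (insert a S) = f S + 1

/-- Envy-freeness up to one good. -/
def EF1 (f : Fin n → Finset I → ℝ) (A : Fin n → Finset I) : Prop :=
  ∀ i j : Fin n, f i (A j) ≤ f i (A i) ∨ ∃ e ∈ A j, f i ((A j).erase e) ≤ f i (A i)

/-- The maximum welfare attainable by a set `S` of agents. -/
noncomputable def maxWelfare (f : Fin n → Finset I → ℕ) (S : Finset (Fin n)) : ℕ :=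
  Finset.sup (Finset.univ.filter fun B : Fin n → Finset I => IsAllocation B)
    (fun B => ∑ j ∈ S, f j (B j))

/-- An allocation extended with index `none` for the set of unallocated items. -/
def extAlloc (A : Fin n → Finset I) : Option (Fin n) → Finset I
  | none => Finset.univ \ Finset.univ.biUnion A
  | some i => A i

/-- If `P` does not EFX-envy `Q`, then the value of `Q` exceeds that of `P` by at most one. -/
lemma card_inter_le_succ_of_EFX {α : Type*} [DecidableEq α] {P Q S : Finset α}
    (h : ∀ e ∈ Q, (Q.erase e ∩ S).card ≤ (P ∩ S).card) :
    (Q ∩ S).card ≤ (P ∩ S).card + 1 := by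
  rcases Q.eq_empty_or_nonempty with rfl | ⟨e, he⟩
  · simp
  · have h1 := h e he
    rw [erase_inter] at h1
    have h2 := pred_card_le_card_erase (s := Q ∩ S) (a := e)
    omega

/-- If `P` does not EFX-envy `Q` but does envy `Q`, then `Q` contains only demanded items. -/
lemma subset_of_EFX_of_lt {α : Type*} [DecidableEq α] {P Q S : Finset α}
    (h : ∀ e ∈ Q, (Q.erase e ∩ S).card ≤ (P ∩ S).card)
    (hlt : (P ∩ S).card < (Q ∩ S).card) : Q ⊆ S := by
  intro e he
  by_contra heS
  have h1 := h e he
  rw [erase_inter, erase_eq_of_notMem (by simp [heS])] at h1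
  omega

/-- A set is split by two complementary sets. -/
lemma card_inter_add_card_inter {α : Type*} [Fintype α] [DecidableEq α] {P Q : Finset α}
    (hd : Disjoint P Q) (hu : P ∪ Q = univ) (S : Finset α) :
    (P ∩ S).card + (Q ∩ S).card = S.card := by
  rw [← card_union_of_disjoint (hd.mono inter_subset_left inter_subset_left),
    ← union_inter_distrib_right, hu, univ_inter]

/-- For two additive dichotomous agents (reporting demand sets) on `m ≥ 21` items, there
is no deterministic truthful allocation mechanism that allocates all items, maximizes
welfare, and is EFX with respect to the reported valuations. -/
theorem no_truthful_welfare_max_EFX_allocating_all_items (m : ℕ) (hm : 21 ≤ m) :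
    ¬ ∃ Mech : (Fin 2 → Finset (Fin m)) → (Fin 2 → Finset (Fin m)),
      -- the mechanism outputs allocations that allocate all items
      (∀ D : Fin 2 → Finset (Fin m),
        IsAllocation (Mech D) ∧ Mech D 0 ∪ Mech D 1 = Finset.univ) ∧
      -- (i) truthfulness
      (∀ D : Fin 2 → Finset (Fin m), ∀ i : Fin 2, ∀ D' : Finset (Fin m),
        (Mech (Function.update D i D') i ∩ D i).card ≤ (Mech D i ∩ D i).card) ∧
      -- (ii) welfare maximization
      (∀ D : Fin 2 → Finset (Fin m), ∀ B : Fin 2 → Finset (Fin m), IsAllocation B →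
        ∑ i, (B i ∩ D i).card ≤ ∑ i, (Mech D i ∩ D i).card) ∧
      -- (iii) EFX with respect to the reported valuations
      (∀ D : Fin 2 → Finset (Fin m), ∀ i j : Fin 2, i ≠ j → ∀ e ∈ Mech D j,
        ((Mech D j).erase e ∩ D i).card ≤ (Mech D i ∩ D i).card) := by
  rintro ⟨Mech, hall, htruth, -, hefx⟩
  have split (S T U : Finset (Fin m)) :
      (Mech ![S, T] 0 ∩ U).card + (Mech ![S, T] 1 ∩ U).card = U.card :=
    card_inter_add_card_inter ((hall _).1 0 1 (by decide)) (hall _).2 U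
  have truth₀ (S T S' : Finset (Fin m)) :
      (Mech ![S', T] 0 ∩ S).card ≤ (Mech ![S, T] 0 ∩ S).card := by
    have h : Function.update ![S, T] 0 S' = ![S', T] := by ext i; fin_cases i <;> simp
    simpa [h] using htruth ![S, T] 0 S'
  have truth₁ (S T T' : Finset (Fin m)) :
      (Mech ![S, T'] 1 ∩ T).card ≤ (Mech ![S, T] 1 ∩ T).card := by
    have h : Function.update ![S, T] 1 T' = ![S, T'] := by ext i; fin_cases i <;> simp
    simpa [h] using htruth ![S, T] 1 T'
  have efx₀ (S T : Finset (Fin m)) : ∀ e ∈ Mech ![S, T] 1,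
      ((Mech ![S, T] 1).erase e ∩ S).card ≤ (Mech ![S, T] 0 ∩ S).card := by
    simpa using hefx ![S, T] 0 1 (by decide)
  have efx₁ (S T : Finset (Fin m)) : ∀ e ∈ Mech ![S, T] 0,
      ((Mech ![S, T] 0).erase e ∩ T).card ≤ (Mech ![S, T] 1 ∩ T).card := by
    simpa using hefx ![S, T] 1 0 (by decide)
  have balanced (S : Finset (Fin m)) :
      (Mech ![S, S] 1 ∩ S).card ≤ (Mech ![S, S] 0 ∩ S).card + 1 ∧
      (Mech ![S, S] 0 ∩ S).card ≤ (Mech ![S, S] 1 ∩ S).card + 1 :=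
    ⟨card_inter_le_succ_of_EFX (efx₀ S S), card_inter_le_succ_of_EFX (efx₁ S S)⟩
  -- `D` consists of six items that agent `0` receives when both agents demand everything.
  obtain ⟨D, hDA, hD⟩ : ∃ D ⊆ Mech ![univ, univ] 0, D.card = 6 := by
    apply exists_subset_card_eq
    have h1 := split univ univ univ
    have h2 := balanced univ
    simp only [inter_univ, card_univ, Fintype.card_fin] at h1 h2
    omega
  -- `C` consists of the three items of `D` that agent `1` receives when both demand `D`.
  obtain ⟨C, hC⟩ : ∃ C, C = Mech ![D, D] 1 ∩ D := ⟨_, rfl⟩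
  have hCD : C ⊆ D := hC ▸ inter_subset_right
  have hC3 : C.card = 3 := by
    have h1 := split D D D
    have h2 := balanced D
    rw [hC]
    omega
  have hsplit := split C C C
  have hbal := balanced C
  rcases lt_or_ge (Mech ![C, C] 1 ∩ C).card (Mech ![C, C] 0 ∩ C).card with hlt | hge
  · have hsub := inter_eq_left.mpr (subset_of_EFX_of_lt (efx₁ C C) hlt)
    have h1 := split C C univ
    have h2 := truth₁ C univ C
    have h3 := split C univ univ
    have h4 := truth₀ C univ univ
    rw [inter_eq_right.mpr (hCD.trans hDA)] at h4
    have h5 := card_le_card (inter_subset_left : Mech ![C, univ] 0 ∩ C ⊆ _)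
    rw [hsub] at hsplit hbal hlt
    simp only [inter_univ] at h1 h2 h3
    omega
  · have hlt : (Mech ![C, C] 0 ∩ C).card < (Mech ![C, C] 1 ∩ C).card := by omega
    have hsub := subset_of_EFX_of_lt (efx₀ C C) hlt
    have h1 := split C C D
    have h2 := truth₀ D C C
    have h3 := split D C D
    have h4 := truth₁ D C D
    rw [inter_eq_right.mpr (hC ▸ inter_subset_left : C ⊆ Mech ![D, D] 1)] at h4
    have h5 := card_le_card (inter_subset_inter_left hCD : Mech ![D, C] 1 ∩ C ⊆ _)
    rw [inter_eq_left.mpr (hsub.trans hCD)] at h1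
    rw [inter_eq_left.mpr hsub] at hsplit hbal hlt
    omega
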